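/- Let S' be any ℤ-submodule of the ℚ-span of S containing S such that ⟨u,v⟩ ∈ ℤ for all u,v ∈ S', ⟨u,u⟩ ∈ 2ℤ for all u ∈ S' (S' is an even overlattice of S), S' ∩ (ℚ-span of Γ_τ) = Γ_τ, and S' ∩ ℚℓ = ℤℓ. Then the index [S' : S] equals 1, 2 or 4. Moreover, such an S' of index 2 exists if and only if t is even, and such an S' of index 4 exists if and only if t ≡ 4 (mod 8). -/

import Mathlib

/- Context: V ⊕ ℚℓ = ℚ^13, coordinates (e₁,…,e₄,n₁,…,n₈,ℓ) (indices 0,…,12),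
Gram matrix D₄(2) ⊕ ⟨-2⟩^8 ⊕ ⟨2t⟩; Γ_τ = Γ_{2,2} the lattice of the paper;
S = Γ_τ + ℤℓ. -/

noncomputable section
open Matrix

abbrev V : Type := Fin 13 → ℚ

/-- Gram matrix: D₄(2) on coordinates 0,…,3; -2·Id on 4,…,11; ⟨ℓ,ℓ⟩ = 2t. -/
def gramG (t : ℤ) : Matrix (Fin 13) (Fin 13) ℚ := Matrix.of fun i j =>
  if i.val = 12 ∨ j.val = 12 then (if i = j then 2 * (t : ℚ) else 0)
  else if i.val < 4 ∧ j.val < 4 then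
    (if i = j then -4 else if i.val = 2 ∨ j.val = 2 then 2 else 0)
  else if i = j then -2 else 0

def B (t : ℤ) (u v : V) : ℚ := u ⬝ᵥ (gramG t *ᵥ v)

def bv : Fin 13 → V := fun i j => if i = j then 1 else 0

/-- ν = (n₁+⋯+n₈)/2 -/
def ν : V := (1/2 : ℚ) • (bv 4 + bv 5 + bv 6 + bv 7 + bv 8 + bv 9 + bv 10 + bv 11)
/-- x₁ = (e₄-e₂+n₂+n₄+n₅+n₆)/2 -/
def x₁ : V := (1/2 : ℚ) • (bv 3 - bv 1 + bv 5 + bv 7 + bv 8 + bv 9)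
/-- x₂ = (e₁-e₂+n₂+n₃+n₅+n₇)/2 -/
def x₂ : V := (1/2 : ℚ) • (bv 0 - bv 1 + bv 5 + bv 6 + bv 8 + bv 10)

/-- The lattice Γ_τ ≅ Γ_{2,2}. -/
def Γτ : Submodule ℤ V :=
  Submodule.span ℤ ({bv 0, bv 1, bv 2, bv 3, bv 4, bv 5, bv 6, bv 7,
    bv 8, bv 9, bv 10, bv 11} ∪ {ν, x₁, x₂})

/-- the polarization class ℓ with ℓ² = 2t -/
def ℓv : V := bv 12

/-- S = Γ_τ ⊕ ℤℓ -/
def S : Submodule ℤ V := Γτ ⊔ Submodule.span ℤ {ℓv}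

/-- S' is an admissible overlattice of S: an even overlattice of S inside the
ℚ-span of S, with S' ∩ (ℚ-span of Γ_τ) = Γ_τ and S' ∩ ℚℓ = ℤℓ. -/
def IsAdmissible (t : ℤ) (S' : Submodule ℤ V) : Prop :=
  S ≤ S' ∧
  S' ≤ (Submodule.span ℚ (S : Set V)).restrictScalars ℤ ∧
  (∀ u ∈ S', ∀ v ∈ S', ∃ n : ℤ, B t u v = (n : ℚ)) ∧
  (∀ u ∈ S', ∃ n : ℤ, B t u u = 2 * (n : ℚ)) ∧
  S' ⊓ (Submodule.span ℚ (Γτ : Set V)).restrictScalars ℤ = Γτ ∧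
  S' ⊓ (Submodule.span ℚ {ℓv}).restrictScalars ℤ = Submodule.span ℤ {ℓv}

/-- the index [S' : S] -/
def idx (S' : Submodule ℤ V) : ℕ :=
  Nat.card (↥S' ⧸ Submodule.comap S'.subtype S)

theorem B_apply (t : ℤ) (u v : V) : B t u v =
    -4 * (u 0 * v 0 + u 1 * v 1 + u 2 * v 2 + u 3 * v 3)
    + 2 * (u 2 * (v 0 + v 1 + v 3) + (u 0 + u 1 + u 3) * v 2)
    - 2 * (u 4 * v 4 + u 5 * v 5 + u 6 * v 6 + u 7 * v 7
      + u 8 * v 8 + u 9 * v 9 + u 10 * v 10 + u 11 * v 11)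
    + 2 * t * (u 12 * v 12) := by
  unfold B gramG
  simp only [Matrix.mulVec, dotProduct, Matrix.of_apply, Fin.sum_univ_succ, Finset.univ_eq_empty,
    Finset.sum_empty]
  norm_num [Fin.succ]
  simp only [Fin.reduceFinMk]
  ring

theorem mem_S_of_forall_int {v : V} (h : ∀ i, ∃ z : ℤ, v i = z) : v ∈ S := by
  choose z hz using h
  have hb : ∀ i, bv i ∈ S := by
    intro i
    by_cases hi : i = 12
    · subst hi
      exact Submodule.mem_sup_right (Submodule.mem_span_singleton_self _)
    · refine Submodule.mem_sup_left (Submodule.subset_span ?_)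
      fin_cases i <;> simp_all
  have hv : v = ∑ i, z i • bv i := by
    ext j
    simp [bv, hz]
  rw [hv]
  exact Submodule.sum_mem _ fun i _ => Submodule.smul_mem _ _ (hb i)

/-- Elements of `S` in coordinates: twice a vector of `S` is integral and its reduction mod `2`
lies in the code spanned by the reductions of `2ν`, `2x₁`, `2x₂`. -/
theorem mem_S_iff {v : V} : v ∈ S ↔ ∃ (a b c : ℤ) (z : Fin 13 → ℤ),
    v 0 = z 0 + c / 2 ∧ v 1 = z 1 + (b + c) / 2 ∧ v 2 = z 2 ∧ v 3 = z 3 + b / 2 ∧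
    v 4 = z 4 + a / 2 ∧ v 5 = z 5 + (a + b + c) / 2 ∧ v 6 = z 6 + (a + c) / 2 ∧
    v 7 = z 7 + (a + b) / 2 ∧ v 8 = z 8 + (a + b + c) / 2 ∧ v 9 = z 9 + (a + b) / 2 ∧
    v 10 = z 10 + (a + c) / 2 ∧ v 11 = z 11 + a / 2 ∧ v 12 = z 12 := by
  constructor
  · intro hv
    let T : Submodule ℤ V :=
      { carrier := {v | ∃ (a b c : ℤ) (z : Fin 13 → ℤ), v = a • ν + b • x₁ + c • x₂ + ∑ i, z i • bv i}
        zero_mem' := ⟨0, 0, 0, 0, by simp⟩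
        add_mem' := by
          rintro _ _ ⟨a, b, c, z, rfl⟩ ⟨a', b', c', z', rfl⟩
          refine ⟨a + a', b + b', c + c', z + z', ?_⟩
          simp only [Pi.add_apply, add_smul, Finset.sum_add_distrib]
          abel
        smul_mem' := by
          rintro k _ ⟨a, b, c, z, rfl⟩
          refine ⟨k * a, k * b, k * c, k • z, ?_⟩
          simp only [Pi.smul_apply, smul_eq_mul, mul_smul, smul_add, Finset.smul_sum] }
    have hb : ∀ i, bv i ∈ T := fun i => ⟨0, 0, 0, Pi.single i 1, by simp [Pi.single_apply]⟩
    have hST : S ≤ T := by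
      refine sup_le (Submodule.span_le.2 ?_) (Submodule.span_le.2 ?_)
      · rintro w (hw | hw)
        · simp only [Set.mem_insert_iff, Set.mem_singleton_iff] at hw
          rcases hw with h | h | h | h | h | h | h | h | h | h | h | h <;> exact h ▸ hb _
        · rcases hw with h | h | h
          · exact ⟨1, 0, 0, 0, by simp [h]⟩
          · exact ⟨0, 1, 0, 0, by simp [h]⟩
          · exact ⟨0, 0, 1, 0, by simp [Set.mem_singleton_iff.1 h]⟩
      · rintro w hw
        exact Set.mem_singleton_iff.1 hw ▸ hb 12
    obtain ⟨a, b, c, z, rfl⟩ := hST hv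
    refine ⟨a, b, c, fun i => z i - if i = 1 then b + c else 0, ?_⟩
    simp [ν, x₁, x₂, bv]
    refine ⟨?_, ?_, ?_, ?_, ?_, ?_, ?_, ?_, ?_, ?_, ?_⟩ <;> ring
  · rintro ⟨a, b, c, z, h0, h1, h2, h3, h4, h5, h6, h7, h8, h9, h10, h11, h12⟩
    have hsub : ∀ w ∈ ({ν, x₁, x₂} : Set V), w ∈ S := fun w hw =>
      Submodule.mem_sup_left (Submodule.subset_span (Or.inr hw))
    have hν := S.smul_mem a (hsub ν (by simp))
    have hx₁ := S.smul_mem b (hsub x₁ (by simp))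
    have hx₂ := S.smul_mem c (hsub x₂ (by simp))
    have key : v - (a • ν + b • x₁ + c • x₂) ∈ S := by
      refine mem_S_of_forall_int fun i => ⟨z i + if i = 1 then b + c else 0, ?_⟩
      fin_cases i <;> simp [ν, x₁, x₂, bv, *] <;> ring
    simpa using S.add_mem key (S.add_mem (S.add_mem hν hx₁) hx₂)

theorem apply_last_of_mem_Γτ {v : V} (hv : v ∈ Γτ) : v 12 = 0 := by
  have : Γτ ≤ LinearMap.ker (LinearMap.proj (R := ℤ) (φ := fun _ : Fin 13 => ℚ) 12) := by
    refine Submodule.span_le.2 ?_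
    rintro w (hw | hw)
    · simp only [Set.mem_insert_iff, Set.mem_singleton_iff] at hw
      rcases hw with h | h | h | h | h | h | h | h | h | h | h | h <;> simp [h, bv]
    · simp only [Set.mem_insert_iff, Set.mem_singleton_iff] at hw
      rcases hw with h | h | h <;> simp [h, bv, ν, x₁, x₂]
  simpa using this hv

theorem mem_Γτ_iff {v : V} : v ∈ Γτ ↔ v ∈ S ∧ v 12 = 0 := by
  refine ⟨fun hv => ⟨Submodule.mem_sup_left hv, apply_last_of_mem_Γτ hv⟩, ?_⟩
  rintro ⟨hv, h0⟩
  obtain ⟨y, hy, z, hz, rfl⟩ := Submodule.mem_sup.1 hv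
  obtain ⟨k, rfl⟩ := Submodule.mem_span_singleton.1 hz
  have : (k : ℚ) = 0 := by simpa [apply_last_of_mem_Γτ hy, ℓv, bv] using h0
  have hk : k = 0 := by exact_mod_cast this
  simpa [hk] using hy

theorem mem_span_Γτ_iff {v : V} : v ∈ Submodule.span ℚ (Γτ : Set V) ↔ v 12 = 0 := by
  constructor
  · intro hv
    have : Submodule.span ℚ (Γτ : Set V) ≤
        LinearMap.ker (LinearMap.proj (R := ℚ) (φ := fun _ : Fin 13 => ℚ) 12) :=
      Submodule.span_le.2 fun w hw => by simpa using apply_last_of_mem_Γτ hw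
    simpa using this hv
  · intro h
    have hv : v = ∑ i, v i • bv i := by
      ext j
      simp [bv]
    rw [hv]
    refine Submodule.sum_mem _ fun i _ => ?_
    by_cases hi : i = 12
    · rw [hi, h, zero_smul]
      exact Submodule.zero_mem _
    · refine Submodule.smul_mem _ _ (Submodule.subset_span (Submodule.subset_span (Or.inl ?_)))
      clear hv
      fin_cases i <;> simp_all

theorem span_S_eq_top : Submodule.span ℚ (S : Set V) = ⊤ := by
  refine Submodule.eq_top_iff'.2 fun v => ?_
  have hv : v = ∑ i, v i • bv i := by
    ext j
    simp [bv]
  rw [hv]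
  refine Submodule.sum_mem _ fun i _ => Submodule.smul_mem _ _ (Submodule.subset_span ?_)
  exact mem_S_of_forall_int fun j => ⟨if i = j then 1 else 0, by simp [bv]⟩

theorem even_of_mem_S (t : ℤ) {v : V} (hv : v ∈ S) : ∃ n : ℤ, B t v v = 2 * (n : ℚ) := by
  obtain ⟨a, b, c, z, h0, h1, h2, h3, h4, h5, h6, h7, h8, h9, h10, h11, h12⟩ := mem_S_iff.1 hv
  refine ⟨-2 * (z 0 ^ 2 + c * z 0 + z 1 ^ 2 + (b + c) * z 1 + z 2 ^ 2 + z 3 ^ 2 + b * z 3)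
    + 2 * z 2 * (z 0 + z 1 + z 3 + b + c) - (b ^ 2 + c ^ 2 + b * c)
    - (z 4 ^ 2 + a * z 4 + z 5 ^ 2 + (a + b + c) * z 5 + z 6 ^ 2 + (a + c) * z 6
      + z 7 ^ 2 + (a + b) * z 7 + z 8 ^ 2 + (a + b + c) * z 8 + z 9 ^ 2 + (a + b) * z 9
      + z 10 ^ 2 + (a + c) * z 10 + z 11 ^ 2 + a * z 11)
    - (2 * a ^ 2 + b ^ 2 + c ^ 2 + 2 * a * b + 2 * a * c + b * c) + t * z 12 ^ 2, ?_⟩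
  rw [B_apply, h0, h1, h2, h3, h4, h5, h6, h7, h8, h9, h10, h11, h12]
  push_cast
  ring

/-- If the last coordinate takes values in `(1/n)ℤ` on `S'`, attains `1/n`, and detects membership
in `S` by integrality, then `S` has index `n` in `S'`. -/
theorem idx_eq_of_apply_last {S' : Submodule ℤ V} {n : ℕ} (hn : 0 < n)
    (hS : ∀ v ∈ S', v ∈ S ↔ ∃ k : ℤ, v 12 = k) (hd : ∀ v ∈ S', ∃ k : ℤ, n * v 12 = k)
    {w : V} (hw : w ∈ S') (hw1 : n * w 12 = 1) : idx S' = n := by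
  have hn0 : (n : ℚ) ≠ 0 := by positivity
  let N := Submodule.comap S'.subtype S
  let f : ℤ →ₗ[ℤ] ↥S' ⧸ N := LinearMap.toSpanSingleton ℤ _ (N.mkQ ⟨w, hw⟩)
  have hf : Function.Surjective f := by
    intro y
    obtain ⟨⟨v, hv⟩, rfl⟩ := N.mkQ_surjective y
    obtain ⟨k, hk⟩ := hd v hv
    refine ⟨k, ?_⟩
    have : f k = N.mkQ (k • ⟨w, hw⟩) := (N.mkQ.map_smul k _).symm
    rw [this, Submodule.mkQ_apply, Submodule.mkQ_apply, Submodule.Quotient.eq]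
    change k • w - v ∈ S
    refine (hS _ (S'.sub_mem (S'.smul_mem k hw) hv)).2 ⟨0, ?_⟩
    have : (n : ℚ) * (k * w 12 - v 12) = 0 := by linear_combination (k : ℚ) * hw1 - hk
    simpa [hn0] using this
  have hker : LinearMap.ker f = Ideal.span {(n : ℤ)} := by
    ext k
    have : f k = N.mkQ (k • ⟨w, hw⟩) := (N.mkQ.map_smul k _).symm
    rw [LinearMap.mem_ker, this, Submodule.mkQ_apply, Submodule.Quotient.mk_eq_zero,
      Ideal.mem_span_singleton]
    change k • w ∈ S ↔ _
    rw [hS _ (S'.smul_mem k hw)]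
    refine exists_congr fun j => ?_
    rw [← @Int.cast_inj ℚ, ← mul_right_inj' hn0]
    simp only [Pi.smul_apply, zsmul_eq_mul, Int.cast_mul, Int.cast_natCast]
    rw [show (n : ℚ) * (k * w 12) = k by linear_combination (k : ℚ) * hw1]
  have e := (LinearMap.quotKerEquivOfSurjective f hf).toEquiv
  rw [hker] at e
  rw [idx, ← Nat.card_congr e, Nat.card_congr (Int.quotientSpanEquivZMod n).toEquiv]
  simp

theorem bv_mem_S (i : Fin 13) : bv i ∈ S :=
  mem_S_of_forall_int fun j => ⟨if i = j then 1 else 0, by simp [bv]⟩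

/-- A criterion for the overlattice generated by `S` and a glue vector `w` with last coordinate
`1 / n` to be admissible of index `n`. -/
theorem exists_isAdmissible {t : ℤ} {n : ℕ} (hn : 0 < n) {w : V} (hw : n * w 12 = 1)
    (hint : ∀ s ∈ S, ∃ m : ℤ, B t s w = m) (hev : ∃ m : ℤ, B t w w = 2 * m)
    (hnw : (n : ℤ) • w ∈ S)
    (hk : ∀ k : ℤ, k • w - (k * w 12) • ℓv ∈ S → (n : ℤ) ∣ k) :
    ∃ S', IsAdmissible t S' ∧ idx S' = n := by
  have hn0 : (n : ℚ) ≠ 0 := by positivity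
  have hmem : ∀ u, u ∈ S ⊔ Submodule.span ℤ {w} ↔ ∃ s ∈ S, ∃ k : ℤ, s + k • w = u := by
    intro u
    simp only [Submodule.mem_sup, Submodule.mem_span_singleton, exists_exists_eq_and]
  have hlast : ∀ s ∈ S, ∃ m : ℤ, s 12 = m := by
    intro s hs
    obtain ⟨a, b, c, z, h⟩ := mem_S_iff.1 hs
    exact ⟨z 12, by tauto⟩
  have heven : ∀ u ∈ S ⊔ Submodule.span ℤ {w}, ∃ m : ℤ, B t u u = 2 * (m : ℚ) := by
    intro u hu
    obtain ⟨s, hs, k, rfl⟩ := (hmem u).1 hu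
    obtain ⟨p, hp⟩ := even_of_mem_S t hs
    obtain ⟨q, hq⟩ := hint s hs
    obtain ⟨r, hr⟩ := hev
    refine ⟨p + k * q + k ^ 2 * r, ?_⟩
    rw [B_apply] at hp hq hr ⊢
    simp only [Pi.add_apply, Pi.smul_apply]
    simp only [zsmul_eq_mul]
    push_cast
    linear_combination hp + 2 * (k : ℚ) * hq + (k : ℚ) ^ 2 * hr
  have hdiv : ∀ s ∈ S, ∀ k j : ℤ, (s + k • w) 12 = j → (n : ℤ) ∣ k := by
    intro s hs k j h
    obtain ⟨m, hm⟩ := hlast s hs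
    refine ⟨j - m, ?_⟩
    have h' : (s 12 : ℚ) + k * w 12 = j := by simpa using h
    have : (k : ℚ) = n * (j - m) := by
      linear_combination (n : ℚ) * h' - (k : ℚ) * hw - (n : ℚ) * hm
    exact_mod_cast this
  have hS : ∀ v ∈ S ⊔ Submodule.span ℤ {w}, v ∈ S ↔ ∃ k : ℤ, v 12 = k := by
    intro v hv
    refine ⟨hlast v, ?_⟩
    rintro ⟨j, hj⟩
    obtain ⟨s, hs, k, rfl⟩ := (hmem v).1 hv
    obtain ⟨i, rfl⟩ := hdiv s hs k j hj
    rw [mul_comm, mul_smul]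
    exact S.add_mem hs (S.smul_mem i hnw)
  refine ⟨S ⊔ Submodule.span ℤ {w}, ⟨le_sup_left, ?_, ?_, heven, ?_, ?_⟩, ?_⟩
  · rw [span_S_eq_top]
    exact fun _ _ => trivial
  · intro u hu v hv
    obtain ⟨p, hp⟩ := heven u hu
    obtain ⟨q, hq⟩ := heven v hv
    obtain ⟨r, hr⟩ := heven _ (Submodule.add_mem _ hu hv)
    refine ⟨r - p - q, ?_⟩
    rw [B_apply] at hp hq hr ⊢
    simp only [Pi.add_apply] at hr
    push_cast
    linear_combination (hr - hp - hq) / 2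
  · ext v
    rw [Submodule.mem_inf, Submodule.restrictScalars_mem, mem_span_Γτ_iff, mem_Γτ_iff]
    exact ⟨fun ⟨h, h0⟩ => ⟨(hS v h).2 ⟨0, by simp [h0]⟩, h0⟩,
      fun ⟨h, h0⟩ => ⟨Submodule.mem_sup_left h, h0⟩⟩
  · ext v
    rw [Submodule.mem_inf, Submodule.restrictScalars_mem]
    constructor
    · rintro ⟨hv, hvℓ⟩
      obtain ⟨q, rfl⟩ := Submodule.mem_span_singleton.1 hvℓ
      obtain ⟨s, hs, k, hsk⟩ := (hmem _).1 hv
      obtain ⟨m, hm⟩ := hlast s hs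
      have h12 : s 12 + k * w 12 = q := by simpa [ℓv, bv] using congrFun hsk 12
      have hkS : k • w - (k * w 12) • ℓv ∈ S := by
        have : k • w - (k * w 12) • ℓv = m • ℓv - s := by
          have hq : k * w 12 = q - m := by rw [← h12, hm]; ring
          rw [hq, sub_smul, ← hsk, Int.cast_smul_eq_zsmul]
          abel
        rw [this]
        exact S.sub_mem (S.smul_mem m (bv_mem_S 12)) hs
      obtain ⟨i, rfl⟩ := hk k hkS
      refine Submodule.mem_span_singleton.2 ⟨m + i, ?_⟩
      rw [← Int.cast_smul_eq_zsmul ℚ]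
      congr 1
      push_cast at h12 ⊢
      linear_combination h12 - hm - (i : ℚ) * hw
    · intro hv
      obtain ⟨k, rfl⟩ := Submodule.mem_span_singleton.1 hv
      refine ⟨Submodule.mem_sup_left (S.smul_mem k (bv_mem_S 12)), ?_⟩
      exact Submodule.smul_of_tower_mem _ k (Submodule.mem_span_singleton_self _)
  · refine idx_eq_of_apply_last hn hS ?_
      (Submodule.mem_sup_right (Submodule.mem_span_singleton_self w)) hw
    intro v hv
    obtain ⟨s, hs, k, rfl⟩ := (hmem v).1 hv
    obtain ⟨m, hm⟩ := hlast s hs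
    refine ⟨n * m + k, ?_⟩
    simp only [Pi.add_apply, Pi.smul_apply]
    simp only [zsmul_eq_mul]
    push_cast
    linear_combination (n : ℚ) * hm + (k : ℚ) * hw

theorem exists_index_two {t : ℤ} (ht : 2 ∣ t) : ∃ S', IsAdmissible t S' ∧ idx S' = 2 := by
  obtain ⟨t, rfl⟩ := ht
  obtain ⟨d, hd⟩ : ∃ d : ℤ, d = 0 ∧ (∃ j, t = 2 * j + 1) ∨ d = 1 ∧ ∃ j, t = 2 * j := by
    rcases Int.even_or_odd' t with ⟨j, h | h⟩
    · exact ⟨1, Or.inr ⟨rfl, j, h⟩⟩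
    · exact ⟨0, Or.inl ⟨rfl, j, h⟩⟩
  refine exists_isAdmissible (n := 2)
    (w := ![0, 0, 0, 0, 1/2, d/2, 0, 0, d/2, 0, 0, 1/2, 1/2]) two_pos ?_ ?_ ?_ ?_ ?_
  · change ((2 : ℕ) : ℚ) * (1 / 2) = 1
    norm_num
  · intro s hs
    obtain ⟨a, b, c, z, h0, h1, h2, h3, h4, h5, h6, h7, h8, h9, h10, h11, h12⟩ := mem_S_iff.1 hs
    refine ⟨-(z 4 + z 11 + a) - d * (z 5 + z 8 + a + b + c) + 2 * t * z 12, ?_⟩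
    rw [B_apply, h0, h1, h2, h3, h4, h5, h6, h7, h8, h9, h10, h11, h12]
    simp
    ring
  · rcases hd with ⟨rfl, j, rfl⟩ | ⟨rfl, j, rfl⟩
    · refine ⟨j, ?_⟩
      rw [B_apply]
      simp
      ring
    · refine ⟨j - 1, ?_⟩
      rw [B_apply]
      simp
      ring
  · refine mem_S_of_forall_int fun i => ⟨![0, 0, 0, 0, 1, d, 0, 0, d, 0, 0, 1, 1] i, ?_⟩
    fin_cases i <;> simp <;> ring
  · intro k hk
    obtain ⟨a, b, c, z, h0, h1, h2, h3, h4, h5, h6, h7, h8, h9, h10, h11, h12⟩ := mem_S_iff.1 hk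
    simp [ℓv, bv] at h0 h3 h4 h6
    field_simp at h0 h3 h4 h6
    norm_cast at h0 h3 h4 h6 ⊢
    omega

theorem exists_index_four {t : ℤ} (ht : t % 8 = 4) : ∃ S', IsAdmissible t S' ∧ idx S' = 4 := by
  obtain ⟨t, rfl⟩ : ∃ s, t = 8 * s + 4 := ⟨t / 8, by omega⟩
  obtain ⟨d, hd⟩ : ∃ d : ℤ, d = 0 ∧ (∃ j, t = 2 * j + 1) ∨ d = 1 ∧ ∃ j, t = 2 * j := by
    rcases Int.even_or_odd' t with ⟨j, h | h⟩
    · exact ⟨1, Or.inr ⟨rfl, j, h⟩⟩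
    · exact ⟨0, Or.inl ⟨rfl, j, h⟩⟩
  refine exists_isAdmissible (n := 4)
    (w := ![1/2, 1/4, 1/2, 1/4, 1/2, d/2, 1/2, 0, d/2, 0, 0, 0, 1/4]) four_pos ?_ ?_ ?_ ?_ ?_
  · change ((4 : ℕ) : ℚ) * (1 / 4) = 1
    norm_num
  · intro s hs
    obtain ⟨a, b, c, z, h0, h1, h2, h3, h4, h5, h6, h7, h8, h9, h10, h11, h12⟩ := mem_S_iff.1 hs
    refine ⟨-(z 0) - c - (z 4 + z 6 + a) - d * (z 5 + z 8 + a + b + c)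
      + (4 * t + 2) * z 12, ?_⟩
    rw [B_apply, h0, h1, h2, h3, h4, h5, h6, h7, h8, h9, h10, h11, h12]
    simp
    ring
  · rcases hd with ⟨rfl, j, rfl⟩ | ⟨rfl, j, rfl⟩
    · refine ⟨j, ?_⟩
      rw [B_apply]
      simp
      ring
    · refine ⟨j - 1, ?_⟩
      rw [B_apply]
      simp
      ring
  · refine mem_S_of_forall_int fun i => ⟨![2, 1, 2, 1, 2, 2 * d, 2, 0, 2 * d, 0, 0, 0, 1] i, ?_⟩
    fin_cases i <;> simp <;> ring
  · intro k hk
    obtain ⟨a, b, c, z, h0, h1, h2, h3, h4, h5, h6, h7, h8, h9, h10, h11, h12⟩ := mem_S_iff.1 hk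
    simp [ℓv, bv] at h0 h2 h3 h7 h9 h10 h11
    field_simp at h0 h2 h3 h7 h9 h10 h11
    norm_cast at h0 h2 h3 h7 h9 h10 h11 ⊢
    omega

theorem apply_last_mem_iff {t : ℤ} {S' : Submodule ℤ V} (h : IsAdmissible t S') :
    ∀ v ∈ S', v ∈ S ↔ ∃ k : ℤ, v 12 = k := by
  obtain ⟨hS, -, -, -, hΓ, -⟩ := h
  intro v hv
  constructor
  · intro hvS
    obtain ⟨a, b, c, z, h⟩ := mem_S_iff.1 hvS
    exact ⟨z 12, by tauto⟩
  · rintro ⟨k, hk⟩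
    have hkS : k • ℓv ∈ S := S.smul_mem k (bv_mem_S 12)
    have : v - k • ℓv ∈ Γτ := by
      rw [← hΓ]
      refine ⟨S'.sub_mem hv (hS hkS), ?_⟩
      change _ ∈ Submodule.span ℚ (Γτ : Set V)
      rw [mem_span_Γτ_iff]
      simp [ℓv, bv, hk]
    simpa using S.add_mem (mem_Γτ_iff.1 this).1 hkS

/-- If `m • v` agrees with a vector of `S` away from the last coordinate, then its last coordinate
is an integer. -/
theorem apply_last_int {t : ℤ} {S' : Submodule ℤ V} (h : IsAdmissible t S') {v : V} (hv : v ∈ S')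
    {m : ℤ} (hm : ∀ i ≠ 12, ∃ k : ℤ, m * v i = k) : ∃ k : ℤ, m * v 12 = k := by
  obtain ⟨hS, -, -, -, -, hℓ⟩ := h
  have h1 : m • v - (m * v 12) • ℓv ∈ S := by
    refine mem_S_of_forall_int fun i => ?_
    by_cases hi : i = 12
    · exact ⟨0, by simp [hi, ℓv, bv]⟩
    · obtain ⟨k, hk⟩ := hm i hi
      exact ⟨k, by simp [ℓv, bv, hk, Ne.symm hi]⟩
  have h2 : (m * v 12) • ℓv ∈ Submodule.span ℤ {ℓv} := by
    rw [← hℓ]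
    refine ⟨by simpa using S'.sub_mem (S'.smul_mem m hv) (hS h1), ?_⟩
    exact Submodule.smul_mem _ _ (Submodule.mem_span_singleton_self _)
  obtain ⟨k, hk⟩ := Submodule.mem_span_singleton.1 h2
  exact ⟨k, by simpa [ℓv, bv] using (congrFun hk 12).symm⟩

/-- The coordinates of an admissible glue vector, in terms of its integral pairings with the
basis. -/
theorem exists_coords {t : ℤ} {S' : Submodule ℤ V} (h : IsAdmissible t S') {w : V} (hw : w ∈ S') :
    ∃ p : Fin 13 → ℤ,
      w 0 = -(2 * p 0 + p 1 + 2 * p 2 + p 3) / 4 ∧ w 1 = -(p 0 + 2 * p 1 + 2 * p 2 + p 3) / 4 ∧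
      w 2 = -(p 0 + p 1 + 2 * p 2 + p 3) / 2 ∧ w 3 = -(p 0 + p 1 + 2 * p 2 + 2 * p 3) / 4 ∧
      w 4 = -p 4 / 2 ∧ w 5 = -p 5 / 2 ∧ w 6 = -p 6 / 2 ∧ w 7 = -p 7 / 2 ∧ w 8 = -p 8 / 2 ∧
      w 9 = -p 9 / 2 ∧ w 10 = -p 10 / 2 ∧ w 11 = -p 11 / 2 ∧
      ∃ N : ℤ, 4 * t * w 12 ^ 2 = (p 0 ^ 2 + p 1 ^ 2 + p 3 ^ 2 + p 0 * p 1 + p 0 * p 3 + p 1 * p 3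
        + 2 * N : ℤ) := by
  obtain ⟨hS, -, hint, hev, -⟩ := h
  obtain ⟨m, hm⟩ := hev w hw
  choose p hp using fun i => hint (bv i) (hS (bv_mem_S i)) w hw
  obtain ⟨q, hq⟩ := hint ν (hS (Submodule.mem_sup_left (Submodule.subset_span (by simp)))) w hw
  simp only [B_apply] at hp hq hm
  have h0 := hp 0
  have h1 := hp 1
  have h2 := hp 2
  have h3 := hp 3
  have h4 := hp 4
  have h5 := hp 5
  have h6 := hp 6
  have h7 := hp 7
  have h8 := hp 8
  have h9 := hp 9
  have h10 := hp 10
  have h11 := hp 11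
  simp [bv] at h0 h1 h2 h3 h4 h5 h6 h7 h8 h9 h10 h11
  have hsum : (p 4 + p 5 + p 6 + p 7 + p 8 + p 9 + p 10 + p 11 : ℚ) = 2 * q := by
    simp [ν, bv] at hq
    linarith
  have hsq : Even (p 4 ^ 2 + p 5 ^ 2 + p 6 ^ 2 + p 7 ^ 2 + p 8 ^ 2 + p 9 ^ 2 + p 10 ^ 2
      + p 11 ^ 2) := by
    have : Even (p 4 + p 5 + p 6 + p 7 + p 8 + p 9 + p 10 + p 11) :=
      even_iff_two_dvd.2 ⟨q, by exact_mod_cast hsum⟩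
    simpa [Int.even_add, Int.even_pow] using this
  obtain ⟨r, hr⟩ := hsq
  replace hr := congrArg (Int.cast : ℤ → ℚ) hr
  push_cast at hr
  have e0 : w 0 = -(2 * p 0 + p 1 + 2 * p 2 + p 3) / 4 := by linarith
  have e1 : w 1 = -(p 0 + 2 * p 1 + 2 * p 2 + p 3) / 4 := by linarith
  have e2 : w 2 = -(p 0 + p 1 + 2 * p 2 + p 3) / 2 := by linarith
  have e3 : w 3 = -(p 0 + p 1 + 2 * p 2 + 2 * p 3) / 4 := by linarith
  have e4 : w 4 = -p 4 / 2 := by linarith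
  have e5 : w 5 = -p 5 / 2 := by linarith
  have e6 : w 6 = -p 6 / 2 := by linarith
  have e7 : w 7 = -p 7 / 2 := by linarith
  have e8 : w 8 = -p 8 / 2 := by linarith
  have e9 : w 9 = -p 9 / 2 := by linarith
  have e10 : w 10 = -p 10 / 2 := by linarith
  have e11 : w 11 = -p 11 / 2 := by linarith
  refine ⟨p, e0, e1, e2, e3, e4, e5, e6, e7, e8, e9, e10, e11,
    2 * m + p 2 ^ 2 + p 2 * (p 0 + p 1 + p 3) + r, ?_⟩
  rw [e0, e1, e2, e3, e4, e5, e6, e7, e8, e9, e10, e11] at hm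
  push_cast
  linear_combination 2 * hm + hr

theorem four_mul_apply_last {t : ℤ} {S' : Submodule ℤ V} (h : IsAdmissible t S') {w : V}
    (hw : w ∈ S') : ∃ k : ℤ, 4 * w 12 = k := by
  obtain ⟨p, h0, h1, h2, h3, h4, h5, h6, h7, h8, h9, h10, h11, -⟩ := exists_coords h hw
  refine apply_last_int (m := 4) h hw fun i hi => ⟨![-(2 * p 0 + p 1 + 2 * p 2 + p 3),
    -(p 0 + 2 * p 1 + 2 * p 2 + p 3), -2 * (p 0 + p 1 + 2 * p 2 + p 3),
    -(p 0 + p 1 + 2 * p 2 + 2 * p 3), -2 * p 4, -2 * p 5, -2 * p 6, -2 * p 7, -2 * p 8,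
    -2 * p 9, -2 * p 10, -2 * p 11, 0] i, ?_⟩
  fin_cases i <;> simp_all <;> ring

theorem even_quadratic_iff (x y z : ℤ) :
    Even (x ^ 2 + y ^ 2 + z ^ 2 + x * y + x * z + y * z) ↔ Even (y + z) ∧ Even (x + z) := by
  simp only [Int.even_add, Int.even_mul, Int.even_pow]
  tauto

theorem two_dvd_of_glue {t : ℤ} {S' : Submodule ℤ V} (h : IsAdmissible t S') {w : V} (hw : w ∈ S')
    (hw2 : 2 * w 12 = 1) : 2 ∣ t := by
  obtain ⟨p, h0, h1, h2, h3, h4, h5, h6, h7, h8, h9, h10, h11, N, hN⟩ := exists_coords h hw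
  have hS : (2 : ℤ) • w ∈ S :=
    (apply_last_mem_iff h _ (S'.smul_mem 2 hw)).2 ⟨1, by simpa using hw2⟩
  obtain ⟨a, b, c, z, g0, -, -, g3, g4, -, g6, g7, -⟩ := mem_S_iff.1 hS
  simp only [Pi.smul_apply] at g0 g3 g4 g6 g7
  simp only [zsmul_eq_mul, h0, h3, h4, h6, h7, Int.cast_ofNat] at g0 g3 g4 g6 g7
  have c0 : -(2 * p 0 + p 1 + 2 * p 2 + p 3) = 2 * z 0 + c := by qify; linarith
  have c3 : -(p 0 + p 1 + 2 * p 2 + 2 * p 3) = 2 * z 3 + b := by qify; linarith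
  have c4 : -(2 * p 4) = 2 * z 4 + a := by qify; linarith
  have c6 : -(2 * p 6) = 2 * z 6 + (a + c) := by qify; linarith
  have c7 : -(2 * p 7) = 2 * z 7 + (a + b) := by qify; linarith
  have hQ := (even_quadratic_iff (p 0) (p 1) (p 3)).2
    ⟨even_iff_two_dvd.2 (by omega), even_iff_two_dvd.2 (by omega)⟩
  have hw12 : w 12 = 1 / 2 := by linarith
  rw [hw12] at hN
  have ht : (t : ℚ) = (p 0 ^ 2 + p 1 ^ 2 + p 3 ^ 2 + p 0 * p 1 + p 0 * p 3 + p 1 * p 3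
      + 2 * N : ℤ) := by
    rw [← hN]
    ring
  rw [Int.cast_inj.1 ht]
  exact dvd_add (even_iff_two_dvd.1 hQ) (dvd_mul_right 2 N)

theorem emod_eight_of_glue {t : ℤ} {S' : Submodule ℤ V} (h : IsAdmissible t S') {w : V}
    (hw : w ∈ S') (hw4 : 4 * w 12 = 1) : t % 8 = 4 := by
  obtain ⟨p, h0, h1, h2, h3, h4, h5, h6, h7, h8, h9, h10, h11, N, hN⟩ := exists_coords h hw
  have hQ : ¬ Even (p 0 ^ 2 + p 1 ^ 2 + p 3 ^ 2 + p 0 * p 1 + p 0 * p 3 + p 1 * p 3) := by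
    rw [even_quadratic_iff]
    rintro ⟨⟨i, hi⟩, ⟨j, hj⟩⟩
    have hi' : (p 1 : ℚ) = 2 * i - p 3 := by
      rw [eq_sub_iff_add_eq]
      exact_mod_cast hi.trans (two_mul i).symm
    have hj' : (p 0 : ℚ) = 2 * j - p 3 := by
      rw [eq_sub_iff_add_eq]
      exact_mod_cast hj.trans (two_mul j).symm
    obtain ⟨k, hk⟩ := apply_last_int (m := 2) h hw fun l hl => ⟨![-(p 0 + p 2 + i),
      -(p 1 + p 2 + j), -(p 0 + p 1 + 2 * p 2 + p 3), -(j + i + p 2), -p 4, -p 5, -p 6, -p 7, -p 8,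
      -p 9, -p 10, -p 11, 0] l, by fin_cases l <;> simp_all <;> ring⟩
    have : (1 : ℚ) = (2 * k : ℤ) := by
      push_cast at hk ⊢
      linarith
    have : 1 = 2 * k := by exact_mod_cast this
    omega
  obtain ⟨q, hq⟩ := Int.not_even_iff_odd.1 hQ
  have hw12 : w 12 = 1 / 4 := by linarith
  rw [hw12, hq] at hN
  have ht : (t : ℚ) = (4 * (2 * q + 1 + 2 * N) : ℤ) := by
    rw [Int.cast_mul, ← hN]
    push_cast
    ring
  have := Int.cast_inj.1 ht
  omega

theorem idx_cases {t : ℤ} {S' : Submodule ℤ V} (h : IsAdmissible t S') :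
    (idx S' = 4 ∧ ∃ w ∈ S', 4 * w 12 = 1) ∨ (idx S' = 2 ∧ ∃ w ∈ S', 2 * w 12 = 1) ∨
      idx S' = 1 := by
  have hℓ : ℓv ∈ S' := h.1 (bv_mem_S 12)
  have hsub : ∀ v ∈ S', ∀ j : ℤ, v - j • ℓv ∈ S' ∧ (v - j • ℓv) 12 = v 12 - j := fun v hv j =>
    ⟨S'.sub_mem hv (S'.smul_mem j hℓ), by simp [ℓv, bv]⟩
  have hS := apply_last_mem_iff h
  by_cases h4 : ∃ w ∈ S', 4 * w 12 = 1
  · obtain ⟨w, hw, hw4⟩ := h4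
    exact Or.inl ⟨idx_eq_of_apply_last four_pos hS (fun v hv => four_mul_apply_last h hv) hw hw4,
      w, hw, hw4⟩
  have hd2 : ∀ v ∈ S', ∃ k : ℤ, 2 * v 12 = k := by
    intro v hv
    obtain ⟨k, hk⟩ := four_mul_apply_last h hv
    obtain ⟨j, hj | hj | hj⟩ : ∃ j, k = 2 * j ∨ k = 4 * j + 1 ∨ k = 4 * j - 1 := by
      have : k % 4 = 0 ∨ k % 4 = 1 ∨ k % 4 = 2 ∨ k % 4 = 3 := by omega
      rcases this with h | h | h | h
      · exact ⟨k / 2, by omega⟩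
      · exact ⟨k / 4, by omega⟩
      · exact ⟨k / 2, by omega⟩
      · exact ⟨k / 4 + 1, by omega⟩
    all_goals
      rw [hj] at hk
      push_cast at hk
    · exact ⟨j, by linarith⟩
    · obtain ⟨h1, h2⟩ := hsub v hv j
      exact absurd ⟨_, h1, by rw [h2]; linarith⟩ h4
    · obtain ⟨h1, h2⟩ := hsub v hv j
      exact absurd ⟨_, S'.neg_mem h1, by rw [Pi.neg_apply, h2]; linarith⟩ h4
  by_cases h2 : ∃ w ∈ S', 2 * w 12 = 1
  · obtain ⟨w, hw, hw2⟩ := h2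
    exact Or.inr (Or.inl ⟨idx_eq_of_apply_last two_pos hS hd2 hw hw2, w, hw, hw2⟩)
  refine Or.inr (Or.inr (idx_eq_of_apply_last one_pos hS (fun v hv => ?_) hℓ (by simp [ℓv, bv])))
  obtain ⟨k, hk⟩ := hd2 v hv
  obtain ⟨j, hj | hj⟩ := Int.even_or_odd' k
  all_goals
    rw [hj] at hk
    push_cast at hk
  · exact ⟨j, by push_cast; linarith⟩
  · obtain ⟨h1, h3⟩ := hsub v hv j
    exact absurd ⟨_, h1, by rw [h3]; linarith⟩ h2

/-- any admissible even overlattice S' of S = Γ_{2,2} ⊕ ⟨2t⟩ has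
index 1, 2 or 4 over S; index 2 is realized iff t is even, and index 4 is
realized iff t ≡ 4 (mod 8). -/
theorem stmt15 (t : ℤ) (ht : 0 < t) :
    (∀ S' : Submodule ℤ V, IsAdmissible t S' →
      idx S' = 1 ∨ idx S' = 2 ∨ idx S' = 4) ∧
    ((∃ S' : Submodule ℤ V, IsAdmissible t S' ∧ idx S' = 2) ↔ 2 ∣ t) ∧
    ((∃ S' : Submodule ℤ V, IsAdmissible t S' ∧ idx S' = 4) ↔ t % 8 = 4) := by
  refine ⟨fun S' h => ?_, ⟨?_, exists_index_two⟩, ⟨?_, exists_index_four⟩⟩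
  · have := idx_cases h
    tauto
  · rintro ⟨S', h, hi⟩
    rcases idx_cases h with ⟨h', -⟩ | ⟨-, w, hw, hw2⟩ | h'
    · omega
    · exact two_dvd_of_glue h hw hw2
    · omega
  · rintro ⟨S', h, hi⟩
    rcases idx_cases h with ⟨-, w, hw, hw4⟩ | ⟨h', -⟩ | h'
    · exact emod_eight_of_glue h hw hw4
    · omega
    · omega
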